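/- There is a constant C > 0 such that for every ω ≥ 1 and every Schwartz function f on ℝ³ = ℝ² × ℝ (variables (x,z)) satisfying the orthogonality condition ∫_ℝ f(x,z) h_ω(z) dz = 0 for every x ∈ ℝ², one has ‖f‖²_{L²} + ‖∇f‖²_{L²} + ω² ‖z f‖²_{L²} ≤ C E_ω(f). -/

import Mathlib

open MeasureTheory Complex

noncomputable section

/-- ℝ² with the Euclidean norm. -/
abbrev R2 : Type := EuclideanSpace ℝ (Fin 2)

/-- ℝ³ written as ℝ² × ℝ, points r = (x, z). -/
abbrev R3 : Type := R2 × ℝ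

/-- Directional derivative of `f` at `p` in the direction `v`. -/
def pd {E F : Type*} [NormedAddCommGroup E] [NormedSpace ℝ E]
    [NormedAddCommGroup F] [NormedSpace ℝ F] (v : E) (f : E → F) (p : E) : F :=
  fderiv ℝ f p v

/-- Second directional derivative in the direction `v`. -/
def pd2 {E F : Type*} [NormedAddCommGroup E] [NormedSpace ℝ E]
    [NormedAddCommGroup F] [NormedSpace ℝ F] (v : E) (f : E → F) (p : E) : F :=
  pd v (pd v f) p

/-- First coordinate direction in the x-plane. -/
def ex0 : R3 := (EuclideanSpace.single 0 1, 0)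

/-- Second coordinate direction in the x-plane. -/
def ex1 : R3 := (EuclideanSpace.single 1 1, 0)

/-- The z-direction. -/
def ez : R3 := (0, 1)

/-- The full Laplacian on ℝ³ = ℝ² × ℝ. -/
def lap3 {F : Type*} [NormedAddCommGroup F] [NormedSpace ℝ F]
    (f : R3 → F) (p : R3) : F :=
  pd2 ex0 f p + pd2 ex1 f p + pd2 ez f p

/-- The operator `S² f = (1−ω)f − Δf + ω² z² f` on functions on ℝ³. -/
def S2op (ω : ℝ) (f : R3 → ℂ) (p : R3) : ℂ :=
  ((1 - ω : ℝ) : ℂ) * f p - lap3 f p + ((ω ^ 2 * p.2 ^ 2 : ℝ) : ℂ) * f p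
/-- Normalized ground state `h_ω(z) = ω^{1/4} π^{-1/4} e^{-ωz²/2}` of `−∂_z² + ω²z²`. -/
def hosc (ω z : ℝ) : ℝ :=
  ω ^ ((1 : ℝ) / 4) * Real.pi ^ (-(1 : ℝ) / 4) * Real.exp (-(ω * z ^ 2) / 2)

/-- The quadratic form
`E_ω(f) = ‖f‖² + ‖∇ₓf‖² + ‖∂_z f‖² + ω²‖z f‖² − ω‖f‖²` on L²(ℝ³). -/
def Eform (ω : ℝ) (f : R3 → ℂ) : ℝ :=
  (∫ p : R3, ‖f p‖ ^ 2) +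
    ((∫ p : R3, ‖pd ex0 f p‖ ^ 2) + (∫ p : R3, ‖pd ex1 f p‖ ^ 2)) +
    (∫ p : R3, ‖pd ez f p‖ ^ 2) +
    ω ^ 2 * (∫ p : R3, p.2 ^ 2 * ‖f p‖ ^ 2) -
    ω * (∫ p : R3, ‖f p‖ ^ 2)

section
variable {E : Type*} [NormedAddCommGroup E] [InnerProductSpace ℝ E]

theorem MeasureTheory.MemLp.integrable_real_inner {α : Type*} [MeasurableSpace α] {μ : Measure α}
    {f g : α → E} (hf : MemLp f 2 μ) (hg : MemLp g 2 μ) :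
    Integrable (fun a => inner ℝ (f a) (g a)) μ :=
  (hf.norm.integrable_mul hg.norm).mono (hf.1.inner hg.1) <| .of_forall fun a => by
    simpa using norm_inner_le_norm (𝕜 := ℝ) (f a) (g a)

/-- The function `z ↦ z g(z)` being square integrable, so is the image of `g` under the lowering
operator. -/
theorem MeasureTheory.MemLp.add_mul_smul {g g' : ℝ → E} (hg' : MemLp g' 2)
    (hzg : MemLp (fun z : ℝ => z • g z) 2) (ω : ℝ) :
    MemLp (fun z : ℝ => g' z + (ω * z) • g z) 2 := by
  simp_rw [mul_smul]
  exact hg'.add (hzg.const_smul ω)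

/-- The lowering operator applied to `g`: completing the square for the harmonic oscillator. -/
theorem integral_norm_sq_deriv_add_smul {g g' : ℝ → E} {ω : ℝ}
    (hd : ∀ z, HasDerivAt g (g' z) z) (hg : MemLp g 2) (hg' : MemLp g' 2)
    (hzg : MemLp (fun z : ℝ => z • g z) 2) :
    ∫ z, ‖g' z + (ω * z) • g z‖ ^ 2 =
      (∫ z, (‖g' z‖ ^ 2 + ω ^ 2 * (z ^ 2 * ‖g z‖ ^ 2) - ω * ‖g z‖ ^ 2)) := by
  have ig : Integrable fun z => ‖g z‖ ^ 2 := hg.integrable_norm_pow (by norm_num)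
  have ig' : Integrable fun z => ‖g' z‖ ^ 2 := hg'.integrable_norm_pow (by norm_num)
  have izg : Integrable fun z : ℝ => z ^ 2 * ‖g z‖ ^ 2 := by
    simpa [norm_smul, mul_pow] using hzg.integrable_norm_pow (p := 2) (by norm_num)
  have ic : Integrable fun z : ℝ => z * inner ℝ (g z) (g' z) := by
    simpa [inner_smul_left] using hzg.integrable_real_inner hg'
  have iz : Integrable fun z : ℝ => z * ‖g z‖ ^ 2 := by
    simpa [inner_smul_left] using hzg.integrable_real_inner hg
  have h0 : ∫ z : ℝ, (‖g z‖ ^ 2 + 2 * (z * inner ℝ (g z) (g' z))) = 0 := by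
    refine integral_eq_zero_of_hasDerivAt_of_integrable (f := fun z : ℝ => z * ‖g z‖ ^ 2)
      (fun z => ?_) (ig.add (ic.const_mul 2)) iz
    convert! (hasDerivAt_id z).mul (hd z).norm_sq using 1
    simp only [id]; ring
  have key : ∀ z : ℝ, ‖g' z + (ω * z) • g z‖ ^ 2 =
      (‖g' z‖ ^ 2 + ω ^ 2 * (z ^ 2 * ‖g z‖ ^ 2) - ω * ‖g z‖ ^ 2) +
        ω * (‖g z‖ ^ 2 + 2 * (z * inner ℝ (g z) (g' z))) := fun z => by
    rw [norm_add_sq_real, norm_smul, mul_pow, inner_smul_right, real_inner_comm,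
      Real.norm_eq_abs, sq_abs]
    ring
  simp_rw [key]
  have i1 : Integrable fun z : ℝ =>
      ‖g' z‖ ^ 2 + ω ^ 2 * (z ^ 2 * ‖g z‖ ^ 2) - ω * ‖g z‖ ^ 2 :=
    (ig'.add (izg.const_mul _)).sub (ig.const_mul _)
  have i2 : Integrable fun z : ℝ => ω * (‖g z‖ ^ 2 + 2 * (z * inner ℝ (g z) (g' z))) :=
    (ig.add (ic.const_mul 2)).const_mul ω
  rw [integral_add i1 i2, integral_const_mul ω, h0]
  simp

theorem integral_Ioi_norm_sq_le_of_zero {g g' : ℝ → E} {ω : ℝ} (hω : 0 < ω)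
    (hd : ∀ z, HasDerivAt g (g' z) z) (hg : MemLp g 2) (hg' : MemLp g' 2)
    (hzg : MemLp (fun z : ℝ => z • g z) 2) (h0 : g 0 = 0) :
    ω / 4 * ∫ z in Set.Ioi (0 : ℝ), ‖g z‖ ^ 2 ≤
      ∫ z in Set.Ioi (0 : ℝ), ‖g' z + (ω * z) • g z‖ ^ 2 := by
  obtain ⟨s, hs, rfl⟩ : ∃ s : ℝ, 0 < s ∧ s ^ 2 = ω := ⟨√ω, Real.sqrt_pos.2 hω, Real.sq_sqrt hω.le⟩
  have ig : Integrable fun z => ‖g z‖ ^ 2 := hg.integrable_norm_pow (by norm_num)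
  have ic : Integrable fun z : ℝ => inner ℝ (g z) (g' z) := hg.integrable_real_inner hg'
  have ia : Integrable fun z : ℝ => ‖g' z + (s ^ 2 * z) • g z‖ ^ 2 :=
    (hg'.add_mul_smul hzg _).integrable_norm_pow (by norm_num)
  set p : ℝ → ℝ := fun z => s / (2 * (1 + s * z)) with hp
  have hp' : ∀ z ∈ Set.Ici (0 : ℝ), HasDerivAt p (-2 * p z ^ 2) z := fun z hz => by
    have hz : 0 ≤ z := hz
    have hne : 1 + s * z ≠ 0 := by positivity
    have h1 : HasDerivAt (fun z : ℝ => 2 * (1 + s * z)) (2 * (s * 1)) z :=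
      (((hasDerivAt_id z).const_mul s).const_add 1).const_mul 2
    convert! (hasDerivAt_const z s).div h1 (by positivity) using 1
    simp only [hp]
    field_simp
    ring
  have hpb : ∀ z ∈ Set.Ioi (0 : ℝ), 0 ≤ p z ∧ p z ≤ s := fun z hz => by
    have hz : 0 < z := hz
    refine ⟨by positivity, ?_⟩
    rw [div_le_iff₀ (by positivity)]
    nlinarith [mul_pos hs hz, mul_pos hs (mul_pos hs hz)]
  have hpm : Measurable p := by fun_prop
  have bdd : ∀ {u : ℝ → ℝ}, Integrable u → IntegrableOn (fun z => p z * u z) (Set.Ioi 0) :=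
    fun {u} hu => by
      refine hu.integrableOn.bdd_mul (c := s) hpm.aestronglyMeasurable ?_
      filter_upwards [ae_restrict_mem measurableSet_Ioi] with z hz
      rw [Real.norm_eq_abs, abs_of_nonneg (hpb z hz).1]
      exact (hpb z hz).2
  have bdd2 : ∀ {u : ℝ → ℝ}, Integrable u → IntegrableOn (fun z => p z ^ 2 * u z) (Set.Ioi 0) :=
    fun {u} hu => by
      refine hu.integrableOn.bdd_mul (c := s ^ 2) (hpm.pow_const 2).aestronglyMeasurable ?_
      filter_upwards [ae_restrict_mem measurableSet_Ioi] with z hz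
      rw [Real.norm_eq_abs, abs_of_nonneg (sq_nonneg _)]
      exact pow_le_pow_left₀ (hpb z hz).1 (hpb z hz).2 2
  have hFd : ∀ z ∈ Set.Ici (0 : ℝ), HasDerivAt (fun z => p z * ‖g z‖ ^ 2)
      (2 * (p z * inner ℝ (g z) (g' z)) - 2 * (p z ^ 2 * ‖g z‖ ^ 2)) z := fun z hz => by
    convert! (hp' z hz).mul (hd z).norm_sq using 1
    ring
  have iF' : IntegrableOn (fun z => 2 * (p z * inner ℝ (g z) (g' z)) - 2 * (p z ^ 2 * ‖g z‖ ^ 2))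
      (Set.Ioi 0) := ((bdd ic).const_mul 2).sub ((bdd2 ig).const_mul 2)
  have hF := integral_Ioi_of_hasDerivAt_of_tendsto' hFd iF'
    (tendsto_zero_of_hasDerivAt_of_integrableOn_Ioi
      (fun z hz => hFd z (Set.Ioi_subset_Ici_self hz)) iF' (bdd ig))
  rw [h0, norm_zero] at hF
  have i1 : IntegrableOn (fun z => s ^ 2 / 4 * ‖g z‖ ^ 2) (Set.Ioi 0) := ig.integrableOn.const_mul _
  have hsplit := integral_add i1 iF'
  rw [hF, integral_const_mul, zero_sub, zero_pow two_ne_zero, mul_zero, neg_zero, add_zero] at hsplit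
  rw [← hsplit]
  refine setIntegral_mono_on (i1.add iF') ia.integrableOn
    measurableSet_Ioi fun z hz => ?_
  have hz : 0 < z := by simpa using hz
  have hsq := sq_nonneg ‖(g' z + (s ^ 2 * z) • g z) - p z • g z‖
  have e1 : inner ℝ (g' z + (s ^ 2 * z) • g z) (p z • g z) =
      p z * inner ℝ (g z) (g' z) + s ^ 2 * z * p z * ‖g z‖ ^ 2 := by
    rw [inner_smul_right, inner_add_left, inner_smul_left, real_inner_self_eq_norm_sq,
      real_inner_comm]
    simp; ring
  rw [norm_sub_sq_real, e1, norm_smul, mul_pow, Real.norm_eq_abs, sq_abs] at hsq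
  have hpot : s ^ 2 / 4 ≤ 2 * (s ^ 2 * z * p z) + p z ^ 2 := by
    have : 2 * (s ^ 2 * z * p z) + p z ^ 2 - s ^ 2 / 4 =
        s ^ 2 * (s * z) * (2 + 3 * (s * z)) / (4 * (1 + s * z) ^ 2) := by
      simp only [hp]
      have hne : 1 + s * z ≠ 0 := by positivity
      field_simp
      ring
    have h2 : 0 ≤ s ^ 2 * (s * z) * (2 + 3 * (s * z)) / (4 * (1 + s * z) ^ 2) := by positivity
    linarith
  nlinarith [mul_le_mul_of_nonneg_right hpot (sq_nonneg ‖g z‖)]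

theorem integral_norm_sq_le_of_zero {g g' : ℝ → E} {ω : ℝ} (hω : 0 < ω)
    (hd : ∀ z, HasDerivAt g (g' z) z) (hg : MemLp g 2) (hg' : MemLp g' 2)
    (hzg : MemLp (fun z : ℝ => z • g z) 2) (h0 : g 0 = 0) :
    ω / 4 * ∫ z, ‖g z‖ ^ 2 ≤ ∫ z, ‖g' z + (ω * z) • g z‖ ^ 2 := by
  have ig : Integrable fun z => ‖g z‖ ^ 2 := hg.integrable_norm_pow (by norm_num)
  have ia : Integrable fun z : ℝ => ‖g' z + (ω * z) • g z‖ ^ 2 :=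
    (hg'.add_mul_smul hzg _).integrable_norm_pow (by norm_num)
  have mp := Measure.measurePreserving_neg (volume : Measure ℝ)
  have hpos := integral_Ioi_norm_sq_le_of_zero hω hd hg hg' hzg h0
  have hneg := integral_Ioi_norm_sq_le_of_zero (g := fun z => g (-z)) (g' := fun z => -g' (-z)) hω
    (fun z => by simpa [Function.comp_def] using (hd (-z)).scomp z (hasDerivAt_neg z))
    (hg.comp_measurePreserving mp) (hg'.comp_measurePreserving mp).neg
    (by simpa [Function.comp_def, Pi.neg_def] using (hzg.comp_measurePreserving mp).neg) (by simpa using h0)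
  have e : ∀ z : ℝ, ‖-g' (-z) + (ω * z) • g (-z)‖ ^ 2 = ‖g' (-z) + (ω * -z) • g (-z)‖ ^ 2 :=
    fun z => by rw [← norm_neg]; congr 2; simp [add_comm]
  simp_rw [e] at hneg
  rw [integral_comp_neg_Ioi (f := fun z => ‖g z‖ ^ 2),
    integral_comp_neg_Ioi (f := fun z => ‖g' z + (ω * z) • g z‖ ^ 2), neg_zero] at hneg
  rw [← intervalIntegral.integral_Iic_add_Ioi (b := 0) ig.integrableOn ig.integrableOn,
    ← intervalIntegral.integral_Iic_add_Ioi (b := 0) ia.integrableOn ia.integrableOn]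
  linarith

end

theorem hosc_pos {ω : ℝ} (hω : 0 < ω) (z : ℝ) : 0 < hosc ω z := by
  unfold hosc; positivity

theorem hasDerivAt_hosc (ω z : ℝ) : HasDerivAt (hosc ω) (-(ω * z) * hosc ω z) z := by
  have h : HasDerivAt (fun z : ℝ => -(ω * z ^ 2) / 2) (-(ω * z)) z := by
    convert! (((hasDerivAt_pow 2 z).const_mul ω).neg).div_const 2 using 1
    simp; ring
  convert! h.exp.const_mul (ω ^ ((1 : ℝ) / 4) * Real.pi ^ (-(1 : ℝ) / 4)) using 1
  unfold hosc; ring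

theorem continuous_hosc (ω : ℝ) : Continuous (hosc ω) := by
  unfold hosc; fun_prop

theorem memLp_hosc {ω : ℝ} (hω : 0 < ω) : MemLp (hosc ω) 2 := by
  refine (memLp_two_iff_integrable_sq (continuous_hosc ω).aestronglyMeasurable).2 ?_
  convert! (integrable_exp_neg_mul_sq hω).const_mul
    ((ω ^ ((1 : ℝ) / 4) * Real.pi ^ (-(1 : ℝ) / 4)) ^ 2) using 2 with z
  simp only [hosc]
  rw [mul_pow _ (Real.exp _), ← Real.exp_nat_mul]
  congr 2; push_cast; ring

theorem memLp_mul_hosc {ω : ℝ} (hω : 0 < ω) : MemLp (fun z => z * hosc ω z) 2 := by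
  refine (memLp_two_iff_integrable_sq
    (continuous_id.mul (continuous_hosc ω)).aestronglyMeasurable).2 ?_
  refine ((integrable_rpow_mul_exp_neg_mul_sq hω (s := 2) (by norm_num)).const_mul
    ((ω ^ ((1 : ℝ) / 4) * Real.pi ^ (-(1 : ℝ) / 4)) ^ 2)).congr (.of_forall fun z => ?_)
  simp only [Pi.mul_apply, id, hosc]
  rw [mul_pow z, mul_pow _ (Real.exp _), ← Real.exp_nat_mul, Real.rpow_ofNat, mul_left_comm]
  congr 3; push_cast; ring_nf

/-- Spectral gap of the harmonic oscillator, with a non-optimal constant. -/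
theorem harmonic_oscillator_gap {g g' : ℝ → ℂ} {ω : ℝ} (hω : 0 < ω)
    (hd : ∀ z, HasDerivAt g (g' z) z) (hg : MemLp g 2) (hg' : MemLp g' 2)
    (hzg : MemLp (fun z : ℝ => z • g z) 2) (horth : ∫ z, hosc ω z • g z = 0) :
    ω / 4 * ∫ z, ‖g z‖ ^ 2 ≤
      ∫ z, (‖g' z‖ ^ 2 + ω ^ 2 * (z ^ 2 * ‖g z‖ ^ 2) - ω * ‖g z‖ ^ 2) := by
  rw [← integral_norm_sq_deriv_add_smul hd hg hg' hzg]
  obtain ⟨c, hc⟩ : ∃ c : ℂ, c = (hosc ω 0)⁻¹ • g 0 := ⟨_, rfl⟩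
  have hsmul : ∀ {u : ℝ → ℝ}, MemLp u 2 → MemLp (fun z => u z • c) 2 := fun {u} hu =>
    (ContinuousLinearMap.toSpanSingleton ℝ c).comp_memLp' hu
  have hh := hsmul (memLp_hosc hω)
  have hzh := hsmul (memLp_mul_hosc hω)
  have hk : MemLp (fun z => g z - hosc ω z • c) 2 := hg.sub hh
  have hk' : MemLp (fun z => g' z + ω • (z * hosc ω z) • c) 2 := hg'.add (hzh.const_smul ω)
  have hzk : MemLp (fun z : ℝ => z • (g z - hosc ω z • c)) 2 := by
    simp_rw [smul_sub, ← mul_smul]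
    exact hzg.sub hzh
  have main := integral_norm_sq_le_of_zero hω (g := fun z => g z - hosc ω z • c)
    (g' := fun z => g' z + ω • (z * hosc ω z) • c)
    (fun z => by
      convert! (hd z).sub ((hasDerivAt_hosc ω z).smul_const c) using 1
      rw [smul_smul, neg_mul, neg_smul, sub_neg_eq_add, mul_assoc])
    hk hk' hzk (by rw [hc, smul_inv_smul₀ (hosc_pos hω 0).ne', sub_self])
  have e : ∀ z, g' z + ω • (z * hosc ω z) • c + (ω * z) • (g z - hosc ω z • c) =
      g' z + (ω * z) • g z := fun z => by
    rw [smul_sub, smul_smul, smul_smul, mul_assoc]; abel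
  simp_rw [e] at main
  refine le_trans (mul_le_mul_of_nonneg_left ?_ (by positivity)) main
  have ig : Integrable fun z => ‖g z‖ ^ 2 := hg.integrable_norm_pow (by norm_num)
  have ihg : Integrable fun z => hosc ω z • g z := memLp_one_iff_integrable.1 (hg.smul (memLp_hosc hω))
  have iin : Integrable fun z => inner ℝ c (hosc ω z • g z) := ihg.const_inner c
  have hin : ∫ z, inner ℝ c (hosc ω z • g z) = 0 := by
    rw [integral_inner ihg, horth, inner_zero_right]
  calc ∫ z, ‖g z‖ ^ 2 = ∫ z, (‖g z‖ ^ 2 - 2 * inner ℝ c (hosc ω z • g z)) := by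
        rw [integral_sub ig (iin.const_mul 2), integral_const_mul, hin]; simp
    _ ≤ _ := by
        refine integral_mono (ig.sub (iin.const_mul 2))
          (hk.integrable_norm_pow (by norm_num)) fun z => ?_
        simp only [norm_sub_sq_real, inner_smul_right, real_inner_comm c]
        linarith [sq_nonneg ‖hosc ω z • c‖]

end


theorem SchwartzMap.exists_slice {F : Type*} [NormedAddCommGroup F] [NormedSpace ℝ F]
    (f : SchwartzMap R3 F) (x : R2) : ∃ g : SchwartzMap ℝ F, ∀ z, g z = f (x, z) := by
  have hT : (fun z : ℝ => ((x, z) : R3)).HasTemperateGrowth := by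
    have h := (Function.HasTemperateGrowth.const (E := ℝ) ((x, 0) : R3)).add
      (ContinuousLinearMap.inr ℝ R2 ℝ).hasTemperateGrowth
    convert! h using 1
    ext1 z
    simp
  refine ⟨SchwartzMap.compCLM ℝ hT ⟨1, 1, fun z => ?_⟩ f, fun z => rfl⟩
  have : ‖z‖ ≤ ‖((x, z) : R3)‖ := norm_snd_le (x, z)
  linarith

theorem SchwartzMap.exists_pd {E F : Type*} [NormedAddCommGroup E] [NormedSpace ℝ E]
    [NormedAddCommGroup F] [NormedSpace ℝ F] (f : SchwartzMap E F) (v : E) :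
    ∃ g : SchwartzMap E F, ∀ p, g p = pd v f p :=
  ⟨LineDeriv.lineDerivOp v f, fun p => by
    rw [SchwartzMap.lineDerivOp_apply, f.differentiableAt.lineDeriv_eq_fderiv]; rfl⟩

theorem SchwartzMap.exists_snd_smul {F : Type*} [NormedAddCommGroup F] [NormedSpace ℝ F]
    (f : SchwartzMap R3 F) : ∃ g : SchwartzMap R3 F, ∀ p, g p = p.2 • f p :=
  ⟨SchwartzMap.smulLeftCLM F (fun p : R3 => p.2) f, fun p =>
    SchwartzMap.smulLeftCLM_apply_apply (ContinuousLinearMap.snd ℝ R2 ℝ).hasTemperateGrowth f p⟩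

theorem hasDerivAt_slice {F : Type*} [NormedAddCommGroup F] [NormedSpace ℝ F]
    {f : R3 → F} (hf : Differentiable ℝ f) (x : R2) (z : ℝ) :
    HasDerivAt (fun z => f (x, z)) (pd ez f (x, z)) z :=
  (hf (x, z)).hasFDerivAt.comp_hasDerivAt z ((hasDerivAt_const z x).prodMk (hasDerivAt_id z))

instance : (volume : Measure R3).IsAddHaarMeasure :=
  inferInstanceAs ((volume : Measure R2).prod (volume : Measure ℝ)).IsAddHaarMeasure

theorem SchwartzMap.integrable_norm_sq {F : Type*} [NormedAddCommGroup F] [NormedSpace ℝ F]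
    (f : SchwartzMap R3 F) : Integrable fun p => ‖f p‖ ^ 2 :=
  (f.memLp 2 volume).integrable_norm_pow (by norm_num)

theorem integral_transversal_energy_ge {ω : ℝ} (hω : 0 < ω) (f : SchwartzMap R3 ℂ)
    (horth : ∀ x : R2, (∫ z : ℝ, f (x, z) * (hosc ω z : ℂ)) = 0) :
    ω / 4 * (∫ p : R3, ‖f p‖ ^ 2) ≤
      (∫ p : R3, ‖pd ez f p‖ ^ 2) + ω ^ 2 * (∫ p : R3, p.2 ^ 2 * ‖f p‖ ^ 2) -
        ω * (∫ p : R3, ‖f p‖ ^ 2) := by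
  obtain ⟨d, hd⟩ := f.exists_pd ez
  obtain ⟨m, hm⟩ := f.exists_snd_smul
  have hm2 : ∀ p, p.2 ^ 2 * ‖f p‖ ^ 2 = ‖m p‖ ^ 2 := fun p => by
    rw [hm, norm_smul, mul_pow, Real.norm_eq_abs, sq_abs]
  have i0 := f.integrable_norm_sq
  have i1 : Integrable fun p : R3 => ‖pd ez f p‖ ^ 2 := by
    simpa only [hd] using d.integrable_norm_sq
  have i2 : Integrable fun p : R3 => p.2 ^ 2 * ‖f p‖ ^ 2 := by
    simpa only [hm2] using m.integrable_norm_sq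
  have i3 : Integrable fun p : R3 =>
      ‖pd ez f p‖ ^ 2 + ω ^ 2 * (p.2 ^ 2 * ‖f p‖ ^ 2) - ω * ‖f p‖ ^ 2 :=
    (i1.add (i2.const_mul _)).sub (i0.const_mul _)
  have i4 : Integrable fun p : R3 => ω / 4 * ‖f p‖ ^ 2 := i0.const_mul _
  have hint : (∫ p : R3, (‖pd ez f p‖ ^ 2 + ω ^ 2 * (p.2 ^ 2 * ‖f p‖ ^ 2) - ω * ‖f p‖ ^ 2)) =
      (∫ p : R3, ‖pd ez f p‖ ^ 2) + ω ^ 2 * (∫ p : R3, p.2 ^ 2 * ‖f p‖ ^ 2) -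
        ω * (∫ p : R3, ‖f p‖ ^ 2) := by
    have h1 := integral_sub (i1.add (i2.const_mul (ω ^ 2))) (i0.const_mul ω)
    have h2 := integral_add i1 (i2.const_mul (ω ^ 2))
    simp only [Pi.add_apply] at h1
    rw [h1, h2, integral_const_mul, integral_const_mul]
  rw [← hint, ← integral_const_mul, Measure.volume_eq_prod, integral_prod _ i3,
    integral_prod _ i4]
  refine integral_mono i4.integral_prod_left i3.integral_prod_left fun x => ?_
  obtain ⟨g, hg⟩ := f.exists_slice x
  obtain ⟨g', hg'⟩ := d.exists_slice x
  obtain ⟨u, hu⟩ := m.exists_slice x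
  simp only [integral_const_mul]
  refine harmonic_oscillator_gap hω (hasDerivAt_slice f.differentiable x) ?_ ?_ ?_ ?_
  · simpa only [← hg] using g.memLp 2 volume
  · simpa only [← hd, ← hg'] using g'.memLp 2 volume
  · convert! u.memLp 2 volume using 2 with z
    rw [hu, hm]
  · rw [← horth x]
    exact integral_congr_ae (.of_forall fun z => by simp [mul_comm])

/-- there is `C > 0` such that for every `ω ≥ 1` and every Schwartz
function `f` on ℝ³ orthogonal (in z) to the ground state `h_ω`,
`‖f‖² + ‖∇f‖² + ω²‖z f‖² ≤ C E_ω(f)`. -/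
theorem coercivity_on_excited_states :
    ∃ C : ℝ, 0 < C ∧ ∀ ω : ℝ, 1 ≤ ω → ∀ f : SchwartzMap R3 ℂ,
      (∀ x : R2, (∫ z : ℝ, f (x, z) * (hosc ω z : ℂ)) = 0) →
      (∫ p : R3, ‖f p‖ ^ 2) +
          ((∫ p : R3, ‖pd ex0 (⇑f) p‖ ^ 2) + (∫ p : R3, ‖pd ex1 (⇑f) p‖ ^ 2) +
            (∫ p : R3, ‖pd ez (⇑f) p‖ ^ 2)) +
          ω ^ 2 * (∫ p : R3, p.2 ^ 2 * ‖f p‖ ^ 2) ≤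
        C * Eform ω (⇑f) := by
  refine ⟨5, by norm_num, fun ω hω f horth => ?_⟩
  have gap := integral_transversal_energy_ge (by linarith) f horth
  have h0 : 0 ≤ ∫ p : R3, ‖f p‖ ^ 2 := integral_nonneg fun p => by positivity
  have hx : 0 ≤ ∫ p : R3, ‖pd ex0 f p‖ ^ 2 := integral_nonneg fun p => by positivity
  have hy : 0 ≤ ∫ p : R3, ‖pd ex1 f p‖ ^ 2 := integral_nonneg fun p => by positivity
  unfold Eform
  linarith
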